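/- Let G1 and G2 be finite groups with G1 abelian and noncyclic, let p be a prime, and let S be a Sylow p-subgroup of G1. If φ : G1 → G2 is a bijection such that for every subset X of G1, X is independent in G1 if and only if φ(X) is independent in G2, then the image φ(S) is (the underlying set of) a Sylow p-subgroup of G2. -/

import Mathlib

/-- A subset `X` of a group is independent if no element of `X` lies in the
subgroup generated by the other elements of `X`. -/
def Independent {G : Type*} [Group G] (X : Set G) : Prop :=
  ∀ x ∈ X, x ∉ Subgroup.closure (X \ {x})

/-- `dgen H` is the least cardinality of a generating set of the subgroup `H`. -/
noncomputable def dgen {G : Type*} [Group G] (H : Subgroup G) : ℕ :=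
  sInf {n : ℕ | ∃ S : Set G, S.Finite ∧ S ⊆ (H : Set G) ∧ Subgroup.closure S = H ∧ S.ncard = n}

/-- A subset `X` of a group is strongly independent if every subgroup `H` containing `X`
satisfies `|X| ≤ d(H)`. -/
def StronglyIndependent {G : Type*} [Group G] (X : Set G) : Prop :=
  ∀ H : Subgroup G, X ⊆ (H : Set G) → X.ncard ≤ dgen H

/-- A group is hamiltonian if it is nonabelian and all of its subgroups are normal. -/
def IsHamiltonian (G : Type*) [Group G] : Prop :=
  (∃ a b : G, a * b ≠ b * a) ∧ ∀ H : Subgroup G, H.Normal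

open Subgroup

/-- Adjacency in the power graph, with every vertex adjacent to itself. -/
def PowAdj {G : Type*} [Group G] (x y : G) : Prop :=
  x ∈ zpowers y ∨ y ∈ zpowers x

/-- Two elements are twins if they have the same closed neighbourhood in the power graph. -/
def PowTwin {G : Type*} [Group G] (x y : G) : Prop :=
  ∀ z, PowAdj x z ↔ PowAdj y z

section PowerGraph

variable {G : Type*} [Group G]

theorem PowAdj.symm {x y : G} (h : PowAdj x y) : PowAdj y x := Or.symm h

theorem PowAdj.refl (x : G) : PowAdj x x := Or.inl (mem_zpowers x)

theorem PowTwin.refl (x : G) : PowTwin x x := fun _ => Iff.rfl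

theorem PowTwin.symm {x y : G} (h : PowTwin x y) : PowTwin y x := fun z => (h z).symm

theorem PowTwin.trans {x y z : G} (h : PowTwin x y) (h' : PowTwin y z) : PowTwin x z :=
  fun w => (h w).trans (h' w)

theorem PowTwin.powAdj {x y : G} (h : PowTwin x y) : PowAdj x y := (h y).2 (PowAdj.refl y)

theorem powTwin_of_zpowers_eq {x y : G} (h : zpowers x = zpowers y) : PowTwin x y := by
  intro z
  simp only [PowAdj, ← zpowers_le, h]

theorem PowAdj.dvd_or_dvd {x y : G} (h : PowAdj x y) :
    orderOf x ∣ orderOf y ∨ orderOf y ∣ orderOf x :=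
  h.imp orderOf_dvd_of_mem_zpowers orderOf_dvd_of_mem_zpowers

variable [Finite G]

theorem zpowers_eq_of_mem_of_orderOf_le {x y : G} (h : y ∈ zpowers x)
    (ho : orderOf x ≤ orderOf y) : zpowers y = zpowers x :=
  Subgroup.eq_of_le_of_card_ge (zpowers_le.2 h) (by simpa only [Nat.card_zpowers] using ho)

theorem mem_zpowers_of_orderOf_dvd {x a b : G} (ha : a ∈ zpowers x) (hb : b ∈ zpowers x)
    (h : orderOf a ∣ orderOf b) : a ∈ zpowers b := by
  classical
  have : Fintype G := Fintype.ofFinite G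
  have hle := IsCyclic.card_pow_eq_one_le (α := zpowers x) (orderOf_pos b)
  let A : Set G := {g | g ∈ zpowers x ∧ g ^ orderOf b = 1}
  have hA : A.ncard ≤ orderOf b := by
    have : A = Subtype.val '' ({g : zpowers x | g ^ orderOf b = 1}) := by
      ext g
      simp only [A, Set.mem_ofPred_eq, Set.mem_image, Subtype.exists, exists_and_right,
        exists_eq_right, Subtype.ext_iff, coe_pow, coe_one, exists_prop]
    rw [this, Set.ncard_image_of_injective _ Subtype.val_injective]
    rw [← Set.ncard_coe_finset] at hle
    simpa using hle
  have hsub : (zpowers b : Set G) ⊆ A := by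
    intro g hg
    exact ⟨zpowers_le.2 hb hg, orderOf_dvd_iff_pow_eq_one.1 (orderOf_dvd_of_mem_zpowers hg)⟩
  have heq : (zpowers b : Set G) = A := by
    apply Set.eq_of_subset_of_ncard_le hsub
    rwa [← Nat.card_coe_set_eq (zpowers b : Set G), SetLike.coe_sort_coe, Nat.card_zpowers]
  have : a ∈ A := ⟨ha, orderOf_dvd_iff_pow_eq_one.1 h⟩
  rwa [← heq] at this

theorem ncard_setOf_zpowers_eq (x : G) :
    {y : G | zpowers x = zpowers y}.ncard = (orderOf x).totient := by
  classical
  have : Fintype G := Fintype.ofFinite G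
  have h := IsCyclic.card_orderOf_eq_totient (α := zpowers x) (d := orderOf x)
    (by rw [← Nat.card_eq_fintype_card, Nat.card_zpowers])
  rw [← h]
  have : {y : G | zpowers x = zpowers y} =
      Subtype.val '' ({g : zpowers x | orderOf g = orderOf x}) := by
    ext g
    simp only [Set.mem_ofPred_eq, Set.mem_image, Subtype.exists, exists_and_right, exists_eq_right,
      orderOf_mk]
    constructor
    · intro h
      refine ⟨h ▸ mem_zpowers g, ?_⟩
      rw [← Nat.card_zpowers, ← h, Nat.card_zpowers]
    · rintro ⟨h, ho⟩
      exact (zpowers_eq_of_mem_of_orderOf_le h ho.ge).symm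
  rw [this, Set.ncard_image_of_injective _ Subtype.val_injective, ← Set.ncard_coe_finset]
  simp

theorem powAdj_of_mem_zpowers {p k : ℕ} (hp : p.Prime) {x a b : G} (hx : orderOf x = p ^ k)
    (ha : a ∈ zpowers x) (hb : b ∈ zpowers x) : PowAdj a b := by
  obtain ⟨i, -, hi⟩ := (Nat.dvd_prime_pow hp).1 (hx ▸ orderOf_dvd_of_mem_zpowers ha)
  obtain ⟨j, -, hj⟩ := (Nat.dvd_prime_pow hp).1 (hx ▸ orderOf_dvd_of_mem_zpowers hb)
  rcases le_total i j with h | h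
  · exact Or.inl (mem_zpowers_of_orderOf_dvd ha hb (hi ▸ hj ▸ pow_dvd_pow p h))
  · exact Or.inr (mem_zpowers_of_orderOf_dvd hb ha (hi ▸ hj ▸ pow_dvd_pow p h))

theorem exists_mem_zpowers_orderOf_eq {x : G} {d : ℕ} (h : d ∣ orderOf x) :
    ∃ y ∈ zpowers x, orderOf y = d :=
  ⟨x ^ (orderOf x / d), npow_mem_zpowers x _, orderOf_pow_orderOf_div (orderOf_pos x).ne' h⟩

/-- If a nontrivial element `v` is a twin of `u` and generates a proper subgroup of `⟨u⟩`, then all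
neighbours of `u` in the power graph have order a power of one prime. -/
theorem PowTwin.exists_prime_orderOf_eq_pow {u v : G} (h : PowTwin u v) (hv : v ≠ 1)
    (hvu : v ∈ zpowers u) (huv : u ∉ zpowers v) :
    ∃ p : ℕ, p.Prime ∧ ∀ z, PowAdj u z → ∃ k, orderOf z = p ^ k := by
  have hmn : orderOf v ∣ orderOf u := orderOf_dvd_of_mem_zpowers hvu
  have hnm : ¬ orderOf u ∣ orderOf v := fun hd =>
    huv (mem_zpowers_of_orderOf_dvd (mem_zpowers u) hvu hd)
  have hm1 : orderOf v ≠ 1 := by rwa [Ne, orderOf_eq_one_iff]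
  have key : ∀ d, d ∣ orderOf u → d ∣ orderOf v ∨ orderOf v ∣ d := by
    intro d hd
    obtain ⟨w, hw, rfl⟩ := exists_mem_zpowers_orderOf_eq hd
    exact ((h w).1 (Or.inr hw)).symm.dvd_or_dvd
  obtain ⟨p, k, hp, hpk, hpk'⟩ : ∃ p k, Nat.Prime p ∧ p ^ k ∣ orderOf u ∧ ¬ p ^ k ∣ orderOf v := by
    by_contra! hcon
    exact hnm ((Nat.dvd_iff_prime_pow_dvd_dvd _ _).2 hcon)
  obtain ⟨j, hj, hjv⟩ := (Nat.dvd_prime_pow hp).1 ((key _ hpk).resolve_left hpk')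
  have hq : ∀ q, q.Prime → q ∣ orderOf u → q = p := by
    intro q hqp hqd
    have hpv : p ∣ orderOf v := by
      rw [hjv]
      apply dvd_pow_self
      rintro rfl
      exact hm1 (by simpa using hjv)
    rcases key q hqd with h | h
    · exact (Nat.prime_dvd_prime_iff_eq hqp hp).1 (hqp.dvd_of_dvd_pow (hjv ▸ h))
    · exact ((Nat.prime_dvd_prime_iff_eq hp hqp).1 (hpv.trans h)).symm
  obtain ⟨n, hn⟩ : ∃ n, orderOf u = p ^ n :=
    ⟨_, Nat.eq_prime_pow_of_unique_prime_dvd (orderOf_pos u).ne' (fun {q} h1 h2 => hq q h1 h2)⟩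
  refine ⟨p, hp, fun z hz => ?_⟩
  rcases hz with hz | hz
  · refine ⟨_, Nat.eq_prime_pow_of_unique_prime_dvd (orderOf_pos z).ne' (fun {q} hqp hqz => ?_)⟩
    by_contra hqne
    have hcop : Nat.Coprime (orderOf u) q := by
      rw [hn]
      exact Nat.Coprime.pow_left _ ((Nat.coprime_primes hp hqp).2 (Ne.symm hqne))
    have hd : orderOf v * q ∣ orderOf z :=
      (hcop.coprime_dvd_left hmn).mul_dvd_of_dvd_of_dvd
        (hmn.trans (orderOf_dvd_of_mem_zpowers hz)) hqz
    obtain ⟨g, hg, hgo⟩ := exists_mem_zpowers_orderOf_eq hd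
    have hvg : v ∈ zpowers g := mem_zpowers_of_orderOf_dvd (zpowers_le.2 hz hvu) hg
      (hgo ▸ dvd_mul_right _ _)
    rcases ((h g).2 (Or.inl hvg)).dvd_or_dvd with h1 | h1
    · rw [hgo] at h1
      exact hnm (hcop.dvd_of_dvd_mul_right h1)
    · exact hqne (hq q hqp ((hgo ▸ dvd_mul_left q _).trans h1))
  · obtain ⟨i, -, hi⟩ := (Nat.dvd_prime_pow hp).1 (hn ▸ orderOf_dvd_of_mem_zpowers hz)
    exact ⟨i, hi⟩

theorem Commute.mem_zpowers_mul_of_coprime {x t : G} (h : Commute x t)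
    (hcop : (orderOf x).Coprime (orderOf t)) : x ∈ zpowers (x * t) := by
  have hx : x ∈ zpowers ((x * t) ^ orderOf t) := by
    rw [h.mul_pow, pow_orderOf_eq_one, mul_one]
    exact mem_zpowers_of_orderOf_dvd (mem_zpowers x) (npow_mem_zpowers x _)
      (by rw [hcop.orderOf_pow])
  exact zpowers_le.2 (npow_mem_zpowers _ _) hx

theorem PowTwin.zpowers_eq_of_card {G : Type*} [CommGroup G] [Finite G] (hnc : ¬ IsCyclic G)
    {a b : ℕ} (ha : a.Prime) (hb : b.Prime) (hab : a ≠ b) (hac : a ∣ Nat.card G)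
    (hbc : b ∣ Nat.card G) {x y : G} (h : PowTwin x y) : zpowers x = zpowers y := by
  have hone : ∀ x : G, PowTwin x 1 → x = 1 := by
    intro x h
    by_contra hx
    have hadj : ∀ z, PowAdj x z := fun z => (h z).2 (Or.inl (one_mem _))
    have hdvd : ∀ q, q.Prime → q ∣ Nat.card G → q ∣ orderOf x := by
      intro q hq hqc
      have := Fact.mk hq
      obtain ⟨t, ht⟩ := exists_prime_orderOf_dvd_card' q hqc
      rcases (hadj t).dvd_or_dvd with h | h
      · rcases (Nat.dvd_prime hq).1 (ht ▸ h) with h | h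
        · exact absurd (orderOf_eq_one_iff.1 h) hx
        · rw [h]
      · exact ht ▸ h
    apply hnc
    have hcard : Nat.card G ∣ orderOf x := by
      rw [Nat.dvd_iff_prime_pow_dvd_dvd]
      intro q k hq hqk
      have := Fact.mk hq
      obtain ⟨K, hK⟩ := Sylow.exists_subgroup_card_pow_prime q hqk
      have hle : K ≤ zpowers x := by
        intro g hg
        refine (hadj g).resolve_left fun hxg => ?_
        have hxK : orderOf x ∣ q ^ k :=
          hK ▸ Subgroup.orderOf_dvd_natCard K (zpowers_le.2 hg hxg)
        have h1 := (Nat.prime_dvd_prime_iff_eq ha hq).1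
          (ha.dvd_of_dvd_pow ((hdvd a ha hac).trans hxK))
        have h2 := (Nat.prime_dvd_prime_iff_eq hb hq).1
          (hb.dvd_of_dvd_pow ((hdvd b hb hbc).trans hxK))
        exact hab (h1.trans h2.symm)
      have := Subgroup.card_dvd_of_le hle
      rwa [hK, Nat.card_zpowers] at this
    exact isCyclic_of_orderOf_eq_card x (Nat.dvd_antisymm (orderOf_dvd_natCard x) hcard)
  have key : ∀ x y : G, PowTwin x y → y ∈ zpowers x → x ∈ zpowers y := by
    intro x y h hyx
    by_contra hxy
    have hy : y ≠ 1 := by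
      rintro rfl
      exact hxy ((hone x h).symm ▸ one_mem _)
    obtain ⟨p, hp, hpow⟩ := h.exists_prime_orderOf_eq_pow hy hyx hxy
    obtain ⟨q, hq, hqc, hqp⟩ : ∃ q, q.Prime ∧ q ∣ Nat.card G ∧ q ≠ p := by
      by_cases h : a = p
      · exact ⟨b, hb, hbc, fun h' => hab (h.trans h'.symm)⟩
      · exact ⟨a, ha, hac, h⟩
    have := Fact.mk hq
    obtain ⟨t, ht⟩ := exists_prime_orderOf_dvd_card' q hqc
    obtain ⟨k, hk⟩ := hpow x (PowAdj.refl x)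
    have hcop : (orderOf x).Coprime (orderOf t) := by
      rw [hk, ht]
      exact Nat.Coprime.pow_left _ ((Nat.coprime_primes hp hq).2 hqp.symm)
    have hord := (Commute.all x t).orderOf_mul_eq_mul_orderOf_of_coprime hcop
    obtain ⟨m, hm⟩ := hpow _ (Or.inl ((Commute.all x t).mem_zpowers_mul_of_coprime hcop))
    have : q ∣ p ^ m := hm ▸ hord ▸ ht ▸ dvd_mul_left _ _
    exact hqp ((Nat.prime_dvd_prime_iff_eq hq hp).1 (hq.dvd_of_dvd_pow this))
  rcases h.powAdj with hxy | hyx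
  · exact le_antisymm (zpowers_le.2 hxy) (zpowers_le.2 (key y x h.symm hxy))
  · exact le_antisymm (zpowers_le.2 (key x y h hyx)) (zpowers_le.2 hyx)

theorem ncard_powTwin_lt_of_mem {p k : ℕ} (hp : p.Prime) {u v w : G}
    (hpow : ∀ z, PowAdj u z → ∃ k, orderOf z = p ^ k) (hk : orderOf u = p ^ k)
    (hu : ∀ z, PowTwin u z → z ∈ zpowers u) (hv : PowTwin u v) (huv : u ∉ zpowers v)
    (hw : w ∈ zpowers u) (hwu : ¬ PowTwin u w) :
    {z | PowTwin w z}.ncard < {z | PowTwin u z}.ncard := by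
  have hsub : {z | PowTwin w z} ⊆ (zpowers u : Set G) \ {z | PowTwin u z} := by
    intro z (hz : PowTwin w z)
    have hzu : PowAdj z u := (hz u).1 (Or.inl hw)
    refine ⟨hzu.resolve_right fun hu' => hwu fun g => ⟨fun hg => ?_, fun hg => ?_⟩,
      fun (h : PowTwin u z) => hwu (h.trans hz.symm)⟩
    · obtain ⟨m, hm⟩ := hpow z (Or.inl hu')
      rcases hg with hg | hg
      · exact Or.inl (zpowers_le.2 hg hw)
      · exact powAdj_of_mem_zpowers hp hk hw hg
    · obtain ⟨m, hm⟩ := hpow z (Or.inl hu')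
      rcases (hz g).1 hg with hg | hg
      · exact Or.inl (zpowers_le.2 hg hu')
      · exact powAdj_of_mem_zpowers hp hm hu' hg
  have h1 := Set.ncard_le_ncard hsub
  have h2 : ((zpowers u : Set G) \ {z | PowTwin u z}).ncard + {z | PowTwin u z}.ncard = p ^ k := by
    have hs : {z | PowTwin u z} ⊆ (zpowers u : Set G) := fun z hz => hu z hz
    rw [Set.ncard_sdiff_add_ncard_of_subset hs, ← hk, ← Nat.card_zpowers,
      ← Nat.card_coe_set_eq, SetLike.coe_sort_coe]
  have h3 : insert v {z | zpowers u = zpowers z} ⊆ {z | PowTwin u z} :=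
    Set.insert_subset hv fun z hz => powTwin_of_zpowers_eq hz
  have h4 := Set.ncard_le_ncard h3
  have hv' : v ∉ {z | zpowers u = zpowers z} :=
    fun h : zpowers u = zpowers v => huv (h ▸ mem_zpowers u)
  rw [Set.ncard_insert_of_notMem hv', ncard_setOf_zpowers_eq, hk] at h4
  rcases k with - | k
  · rw [pow_zero, orderOf_eq_one_iff] at hk
    exact absurd (hk ▸ one_mem _) huv
  · rw [Nat.totient_prime_pow_succ hp] at h4
    have : p ^ (k + 1) ≤ 2 * (p ^ k * (p - 1)) := by
      have := hp.two_le
      rw [pow_succ, mul_left_comm]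
      exact Nat.mul_le_mul_left _ (by omega)
    omega

theorem ncard_powTwin_lt_of_notMem {p m : ℕ} (hp : p.Prime) {u w : G}
    (hm : orderOf w = p ^ m) (hu : ∀ z, PowTwin u z → z ∈ zpowers u) (hu1 : ¬ PowTwin u 1)
    (huw : u ∈ zpowers w) (hwu : w ∉ zpowers u) :
    {z | PowTwin u z}.ncard < {z | PowTwin w z}.ncard := by
  obtain ⟨k, hkm, hk⟩ := (Nat.dvd_prime_pow hp).1 (hm ▸ orderOf_dvd_of_mem_zpowers huw)
  have hne : k ≠ m := by
    rintro rfl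
    exact hwu (mem_zpowers_of_orderOf_dvd (mem_zpowers w) huw (by rw [hm, hk]))
  have h1 : {z | PowTwin u z}.ncard < p ^ k := by
    have : {z | PowTwin u z} ⊂ (zpowers u : Set G) :=
      ⟨fun z hz => hu z hz, fun h => hu1 (h (one_mem (zpowers u)))⟩
    have := Set.ncard_lt_ncard this
    rwa [← Nat.card_coe_set_eq (zpowers u : Set G), SetLike.coe_sort_coe, Nat.card_zpowers,
      hk] at this
  have h2 : (p ^ m).totient ≤ {z | PowTwin w z}.ncard := by
    rw [← hm, ← ncard_setOf_zpowers_eq]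
    exact Set.ncard_le_ncard fun z hz => powTwin_of_zpowers_eq hz
  obtain ⟨m, rfl⟩ : ∃ n, m = n + 1 := ⟨m - 1, by omega⟩
  rw [Nat.totient_prime_pow_succ hp] at h2
  have h3 : p ^ k ≤ p ^ m := Nat.pow_le_pow_right hp.pos (by omega)
  have h4 : p ^ m ≤ p ^ m * (p - 1) :=
    Nat.le_mul_of_pos_right _ (by have := hp.two_le; omega)
  omega

end PowerGraph

section PowerGraphIso

variable {G H : Type*} [Group G] [Group H] {φ : G ≃ H}

theorem powTwin_apply_iff (hφ : ∀ x y, PowAdj (φ x) (φ y) ↔ PowAdj x y) {x y : G} :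
    PowTwin (φ x) (φ y) ↔ PowTwin x y := by
  simp only [PowTwin, φ.surjective.forall, hφ]

theorem ncard_powTwin_apply (hφ : ∀ x y, PowAdj (φ x) (φ y) ↔ PowAdj x y) (x : G) :
    {z | PowTwin (φ x) z}.ncard = {z | PowTwin x z}.ncard := by
  have : {z | PowTwin (φ x) z} = φ '' {z | PowTwin x z} := by
    ext z
    obtain ⟨z, rfl⟩ := φ.surjective z
    simp [powTwin_apply_iff hφ]
  rw [this, Set.ncard_image_of_injective _ φ.injective]

theorem ncard_powTwin_eq_totient [Finite G] (hG : ∀ x y : G, PowTwin x y → zpowers x = zpowers y)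
    (x : G) : {z | PowTwin x z}.ncard = (orderOf x).totient := by
  rw [← ncard_setOf_zpowers_eq]
  congr 1
  ext z
  exact ⟨hG x z, powTwin_of_zpowers_eq⟩

theorem totient_le_of_dvd {m n : ℕ} (h : m ∣ n) (hn : n ≠ 0) : m.totient ≤ n.totient :=
  Nat.le_of_dvd (Nat.totient_pos.2 (Nat.pos_of_ne_zero hn)) (Nat.totient_dvd_of_dvd h)

theorem even_and_odd_of_totient_eq {m n : ℕ} (h : m ∣ n) (hn : n ≠ 0) (hmn : m ≠ n)
    (ht : m.totient = n.totient) : Even n ∧ Odd m := by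
  obtain ⟨k, rfl⟩ := h
  have hm : 0 < m.totient := Nat.totient_pos.2 (Nat.pos_of_ne_zero (left_ne_zero_of_mul hn))
  have hk : 0 < k.totient := Nat.totient_pos.2 (Nat.pos_of_ne_zero (right_ne_zero_of_mul hn))
  have h1 : m.totient * k.totient ≤ m.totient * 1 := by
    rw [mul_one]
    exact ht ▸ Nat.totient_super_multiplicative m k
  have h2 : k.totient = 1 := le_antisymm (Nat.le_of_mul_le_mul_left h1 hm) hk
  rcases Nat.totient_eq_one_iff.1 h2 with rfl | rfl
  · exact absurd (mul_one m).symm hmn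
  · refine ⟨even_two.mul_left m, Nat.not_even_iff_odd.1 fun hev => ?_⟩
    rw [mul_comm, Nat.totient_two_mul_of_even hev] at ht
    omega

variable [Finite G] [Finite H]

theorem apply_mem_zpowers (hG : ∀ x y : G, PowTwin x y → zpowers x = zpowers y)
    (hH : ∀ x y : H, PowTwin x y → zpowers x = zpowers y) (h1 : φ 1 = 1)
    (hφ : ∀ x y, PowAdj (φ x) (φ y) ↔ PowAdj x y) {x y : G} (hyx : y ∈ zpowers x) :
    φ y ∈ zpowers (φ x) := by
  rcases (hφ y x).2 (Or.inl hyx) with h | h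
  · exact h
  by_contra hne
  have htot : ∀ z, (orderOf (φ z)).totient = (orderOf z).totient := fun z => by
    rw [← ncard_powTwin_eq_totient hG, ← ncard_powTwin_eq_totient hH, ncard_powTwin_apply hφ]
  have hxy : zpowers y ≠ zpowers x := fun he =>
    hne (hH _ _ ((powTwin_apply_iff hφ).2 (powTwin_of_zpowers_eq he)) ▸ mem_zpowers _)
  have hd1 := orderOf_dvd_of_mem_zpowers hyx
  have hd2 := orderOf_dvd_of_mem_zpowers h
  have he : (orderOf y).totient = (orderOf x).totient :=
    le_antisymm (totient_le_of_dvd hd1 (orderOf_pos x).ne')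
      (by simpa only [htot] using totient_le_of_dvd hd2 (orderOf_pos (φ y)).ne')
  have hev := (even_and_odd_of_totient_eq hd1 (orderOf_pos x).ne'
    (fun h => hxy (zpowers_eq_of_mem_of_orderOf_le hyx h.ge)) he).1
  have hodd := (even_and_odd_of_totient_eq hd2 (orderOf_pos (φ y)).ne'
    (fun h' => hne (zpowers_eq_of_mem_of_orderOf_le h h'.ge ▸ mem_zpowers _))
    (by rw [htot, htot, he])).2
  obtain ⟨t, ht, hto⟩ := exists_mem_zpowers_orderOf_eq hev.two_dvd
  have ht1 : φ t ≠ 1 := by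
    rw [← h1, Ne, φ.injective.eq_iff, ← orderOf_eq_one_iff, hto]
    decide
  have hφt : orderOf (φ t) = 2 := by
    have := htot t
    rw [hto, Nat.totient_two, Nat.totient_eq_one_iff, orderOf_eq_one_iff] at this
    exact this.resolve_left ht1
  rcases ((hφ t x).2 (Or.inl ht)).dvd_or_dvd with h | h
  · exact Nat.not_even_iff_odd.2 hodd ((even_iff_two_dvd).2 (hφt ▸ h))
  · rw [hφt] at h
    rcases (Nat.dvd_prime Nat.prime_two).1 h with h | h
    · rw [orderOf_eq_one_iff, ← h1, φ.injective.eq_iff] at h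
      rw [h, orderOf_one] at hev
      exact absurd hev (by decide)
    · rw [h] at hodd
      exact absurd hodd (by decide)

theorem orderOf_apply (hG : ∀ x y : G, PowTwin x y → zpowers x = zpowers y)
    (hH : ∀ x y : H, PowTwin x y → zpowers x = zpowers y) (h1 : φ 1 = 1)
    (hφ : ∀ x y, PowAdj (φ x) (φ y) ↔ PowAdj x y) (x : G) : orderOf (φ x) = orderOf x := by
  have himage : φ '' (zpowers x : Set G) = (zpowers (φ x) : Set H) := by
    ext z
    obtain ⟨z, rfl⟩ := φ.surjective z
    rw [φ.injective.mem_set_image]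
    refine ⟨apply_mem_zpowers hG hH h1 hφ, fun h => ?_⟩
    have := apply_mem_zpowers (φ := φ.symm) hH hG (by rw [← h1, φ.symm_apply_apply])
      (fun a b => by rw [← hφ, φ.apply_symm_apply, φ.apply_symm_apply]) h
    simpa using this
  have := congrArg Set.ncard himage
  rw [Set.ncard_image_of_injective _ φ.injective] at this
  simpa [← Nat.card_coe_set_eq, Nat.card_zpowers] using this.symm

theorem PowTwin.zpowers_eq_of_iso (hG : ∀ x y : G, PowTwin x y → zpowers x = zpowers y)
    (hcomm : ∀ x y : G, x * y = y * x) {a b : ℕ} (ha : a.Prime) (hb : b.Prime) (hab : a ≠ b)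
    (hac : a ∣ Nat.card G) (hbc : b ∣ Nat.card G) (h1 : φ 1 = 1)
    (hφ : ∀ x y, PowAdj (φ x) (φ y) ↔ PowAdj x y) {y y' : H} (h : PowTwin y y') :
    zpowers y = zpowers y' := by
  by_contra hne
  have hone : ∀ z : H, PowTwin z 1 → z = 1 := by
    intro z hz
    obtain ⟨z, rfl⟩ := φ.surjective z
    rw [← h1, powTwin_apply_iff hφ] at hz
    have := hG _ _ hz
    rw [zpowers_one_eq_bot, zpowers_eq_bot] at this
    rw [this, h1]
  obtain ⟨u, hyu, hmax⟩ := Set.exists_max_image {z | PowTwin y z} orderOf (Set.toFinite _)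
    ⟨y, PowTwin.refl y⟩
  replace hyu : PowTwin y u := hyu
  have hu : ∀ z, PowTwin u z → z ∈ zpowers u := by
    intro z hz
    rcases hz.powAdj with huz | hzu
    · rw [zpowers_eq_of_mem_of_orderOf_le huz (hmax z (hyu.trans hz))]
      exact mem_zpowers z
    · exact hzu
  obtain ⟨v, hv, huv⟩ : ∃ v, PowTwin u v ∧ u ∉ zpowers v := by
    by_contra! hcon
    have key : ∀ z, PowTwin u z → zpowers z = zpowers u := fun z hz =>
      le_antisymm (zpowers_le.2 (hu z hz)) (zpowers_le.2 (hcon z hz))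
    exact hne ((key y hyu.symm).trans (key y' (hyu.symm.trans h)).symm)
  have hu1 : ¬ PowTwin u 1 := by
    intro h
    rw [hone u h] at huv
    exact huv (one_mem _)
  obtain ⟨p, hp, hpow⟩ := hv.exists_prime_orderOf_eq_pow
    (by rintro rfl; exact hu1 hv) (hu v hv) huv
  obtain ⟨k, hk⟩ := hpow u (PowAdj.refl u)
  obtain ⟨x, rfl⟩ := φ.surjective u
  have hx1 : orderOf x ≠ 1 := by
    rw [Ne, orderOf_eq_one_iff]
    rintro rfl
    exact hu1 (h1 ▸ PowTwin.refl _)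
  have hlow : ∀ w, φ w ∈ zpowers (φ x) → ¬ PowTwin x w →
      (orderOf w).totient < (orderOf x).totient := by
    intro w hw hwx
    have := ncard_powTwin_lt_of_mem hp hpow hk hu hv huv hw (by rwa [powTwin_apply_iff hφ])
    rwa [ncard_powTwin_apply hφ, ncard_powTwin_apply hφ, ncard_powTwin_eq_totient hG,
      ncard_powTwin_eq_totient hG] at this
  have hhigh : ∀ w, φ x ∈ zpowers (φ w) → φ w ∉ zpowers (φ x) →
      (orderOf x).totient < (orderOf w).totient := by
    intro w hw hwx
    obtain ⟨m, hm⟩ := hpow _ (Or.inl hw)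
    have := ncard_powTwin_lt_of_notMem hp hm hu hu1 hw hwx
    rwa [ncard_powTwin_apply hφ, ncard_powTwin_apply hφ, ncard_powTwin_eq_totient hG,
      ncard_powTwin_eq_totient hG] at this
  by_cases hdvd : ∀ l, l.Prime → l ∣ Nat.card G → l ∣ orderOf x
  · obtain ⟨t, ht, hta⟩ := exists_mem_zpowers_orderOf_eq (hdvd a ha hac)
    obtain ⟨s, hs, hsb⟩ := exists_mem_zpowers_orderOf_eq (hdvd b hb hbc)
    have hts : ¬ PowAdj t s := by
      intro h
      rcases h.dvd_or_dvd with h | h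
      · rw [hta, hsb, Nat.prime_dvd_prime_iff_eq ha hb] at h
        exact hab h
      · rw [hta, hsb, Nat.prime_dvd_prime_iff_eq hb ha] at h
        exact hab h.symm
    by_cases htx : φ t ∈ zpowers (φ x)
    · rw [← hφ] at hts
      rcases (hφ x s).2 (Or.inr hs) with h | h
      · exact hts (Or.inl (zpowers_le.2 h htx))
      · exact hts (powAdj_of_mem_zpowers hp hk htx h)
    · have := hhigh t (((hφ x t).2 (Or.inr ht)).resolve_right htx) htx
      exact absurd (totient_le_of_dvd (orderOf_dvd_of_mem_zpowers ht) (orderOf_pos x).ne')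
        (not_le.2 this)
  · push Not at hdvd
    obtain ⟨l, hl, hlc, hlx⟩ := hdvd
    have := Fact.mk hl
    obtain ⟨t, ht⟩ := exists_prime_orderOf_dvd_card' l hlc
    have hcop : (orderOf x).Coprime (orderOf t) := by
      rw [ht]
      exact ((Nat.Prime.coprime_iff_not_dvd hl).2 hlx).symm
    have hxt : Commute x t := hcomm x t
    have hord := hxt.orderOf_mul_eq_mul_orderOf_of_coprime hcop
    have hxm : x ∈ zpowers (x * t) := hxt.mem_zpowers_mul_of_coprime hcop
    have htm : t ∈ zpowers (x * t) := by
      rw [hxt.eq]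
      exact hxt.symm.mem_zpowers_mul_of_coprime hcop.symm
    have hntx : ¬ PowAdj x t := by
      intro h
      rcases h.dvd_or_dvd with h | h
      · exact hx1 (Nat.eq_one_of_dvd_coprimes hcop dvd_rfl h)
      · exact hlx (ht ▸ h)
    have hw := (hφ x (x * t)).2 (Or.inl hxm)
    by_cases hwx : φ (x * t) ∈ zpowers (φ x)
    · have := hlow _ hwx fun h => hntx ((h t).2 (Or.inr htm))
      exact absurd (totient_le_of_dvd (hord ▸ dvd_mul_right _ _) (orderOf_pos (x * t)).ne')
        (not_le.2 this)
    · have hxw := hw.resolve_right hwx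
      rw [← hφ] at hntx
      obtain ⟨m, hm⟩ := hpow _ (Or.inl hxw)
      rcases (hφ t (x * t)).2 (Or.inl htm) with h | h
      · exact hntx (powAdj_of_mem_zpowers hp hm hxw h)
      · exact hntx (Or.inl (zpowers_le.2 h hxw))

end PowerGraphIso

theorem independent_singleton_iff {G : Type*} [Group G] {x : G} :
    Independent {x} ↔ x ≠ 1 := by
  simp [Independent]

theorem independent_pair_iff {G : Type*} [Group G] {x y : G} (h : x ≠ y) :
    Independent {x, y} ↔ ¬ PowAdj x y := by
  have h1 : ({x, y} : Set G) \ {x} = {y} := by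
    ext z
    simp only [Set.mem_sdiff, Set.mem_insert_iff, Set.mem_singleton_iff]
    grind
  have h2 : ({x, y} : Set G) \ {y} = {x} := by
    ext z
    simp only [Set.mem_sdiff, Set.mem_insert_iff, Set.mem_singleton_iff]
    grind
  simp [Independent, h1, h2, PowAdj, zpowers_eq_closure]

theorem indep_iso_maps_sylow_to_sylow
    (G₁ G₂ : Type) [CommGroup G₁] [Finite G₁] [Group G₂] [Finite G₂]
    (hnc : ¬ IsCyclic G₁) (p : ℕ) (hp : p.Prime) (S : Sylow p G₁)
    (φ : G₁ ≃ G₂) (hφ : ∀ X : Set G₁, Independent X ↔ Independent (φ '' X)) :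
    ∃ T : Sylow p G₂, φ '' ((S : Subgroup G₁) : Set G₁) = ((T : Subgroup G₂) : Set G₂) := by
  have := Fact.mk hp
  have h1 : φ 1 = 1 := by
    have := hφ {1}
    rw [Set.image_singleton, independent_singleton_iff, independent_singleton_iff] at this
    by_contra h
    exact this.2 h rfl
  have hadj : ∀ x y, PowAdj (φ x) (φ y) ↔ PowAdj x y := by
    intro x y
    rcases eq_or_ne x y with rfl | hxy
    · simp only [PowAdj.refl]
    · have := hφ {x, y}
      rw [Set.image_pair, independent_pair_iff hxy, independent_pair_iff (φ.injective.ne hxy),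
        not_iff_not] at this
      exact this.symm
  have hcard : Nat.card G₁ = Nat.card G₂ := Nat.card_congr φ
  let T : Sylow p G₂ := default
  refine ⟨T, ?_⟩
  have hST : ((T : Subgroup G₂) : Set G₂).ncard = (φ '' ((S : Subgroup G₁) : Set G₁)).ncard := by
    rw [Set.ncard_image_of_injective _ φ.injective]
    simp only [← Nat.card_coe_set_eq, SetLike.coe_sort_coe]
    exact T.card_eq_multiplicity.trans (hcard ▸ S.card_eq_multiplicity.symm)
  symm
  refine Set.eq_of_subset_of_ncard_le ?_ hST.ge
  by_cases hpr : ∃ q, q.Prime ∧ q ∣ Nat.card G₁ ∧ q ≠ p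
  swap
  · push Not at hpr
    have hG : IsPGroup p G₁ := IsPGroup.of_card
      (Nat.eq_prime_pow_of_unique_prime_dvd Nat.card_pos.ne' (fun {q} h h' => hpr q h h'))
    have hS : (S : Subgroup G₁) = ⊤ :=
      (S.is_maximal' (hG.to_subgroup ⊤) le_top).symm
    simp [hS]
  obtain ⟨q, hq, hqc, hqp⟩ := hpr
  by_cases hpc : p ∣ Nat.card G₁
  · have hG₁ : ∀ x y : G₁, PowTwin x y → zpowers x = zpowers y := fun x y h =>
      h.zpowers_eq_of_card hnc hq hp hqp hqc hpc
    have hG₂ : ∀ x y : G₂, PowTwin x y → zpowers x = zpowers y := fun x y h =>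
      h.zpowers_eq_of_iso hG₁ mul_comm hq hp hqp hqc hpc h1 hadj
    intro g hg
    obtain ⟨x, rfl⟩ := φ.surjective g
    rw [φ.injective.mem_set_image]
    obtain ⟨k, hk⟩ := IsPGroup.iff_orderOf.1 T.isPGroup' ⟨φ x, hg⟩
    rw [orderOf_mk, orderOf_apply hG₁ hG₂ h1 hadj] at hk
    have hx : IsPGroup p (zpowers x) := IsPGroup.of_card (by rw [Nat.card_zpowers, hk])
    exact hx.le_sylow_of_normal S (mem_zpowers x)
  · intro g hg
    obtain ⟨k, hk⟩ := IsPGroup.iff_orderOf.1 T.isPGroup' ⟨g, hg⟩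
    rw [orderOf_mk] at hk
    have hg1 : g = 1 := by
      rw [← orderOf_eq_one_iff, hk]
      rcases k with - | k
      · rfl
      · exact absurd ((dvd_pow_self p k.succ_ne_zero).trans (hk ▸ hcard ▸ orderOf_dvd_natCard g))
          hpc
    exact ⟨1, one_mem S, by rw [h1, hg1]⟩
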